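/- For all integers 0 ≤ k ≤ j, the following identity holds in ℚ(q): ∑_{h=k}^{j} (−q)^{h−j} q^{h²} [h; k]_+ [j; h]_+ = (−q)^{k−j} q^{k²} (q^{2+2k}; q²)_{j−k} [j; k]_+. (This is the product form of the rescaled top twist rule applied to the basis web UP[j,k].) -/

import Mathlib

noncomputable section

open Finset

/-- The field `ℚ(q)` of rational functions in one variable. -/
abbrev F : Type := RatFunc ℚ

/-- The variable `q`. -/
def q : F := RatFunc.X

/-- The q-Pochhammer symbol `(x; y)_n = ∏_{j=0}^{n-1} (1 - x yʲ)`. -/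
def qPoch (x y : F) (n : ℕ) : F := ∏ i ∈ Finset.range n, (1 - x * y ^ i)

/-- `(q²;q²)_m = ∏_{i=1}^{m} (1 - q^{2i})`. -/
def qp (m : ℕ) : F := qPoch (q ^ 2) (q ^ 2) m

/-- The positive quantum binomial coefficient `[N; k]₊`. -/
def qbin (N k : ℕ) : F := qp N / (qp k * qp (N - k))

/-- The Gaussian binomial coefficient with base `p`, defined by the Pascal recursion. -/
def gaussBinom {R : Type*} [CommRing R] (p : R) : ℕ → ℕ → R
  | _, 0 => 1
  | 0, _ + 1 => 0
  | n + 1, i + 1 => gaussBinom p n i + p ^ (i + 1) * gaussBinom p n (i + 1)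

section GaussBinom

variable {R : Type*} [CommRing R] (p : R)

theorem gaussBinom_zero_right (n : ℕ) : gaussBinom p n 0 = 1 := by
  cases n <;> rfl

theorem gaussBinom_succ_succ (n i : ℕ) :
    gaussBinom p (n + 1) (i + 1) = gaussBinom p n i + p ^ (i + 1) * gaussBinom p n (i + 1) := rfl

theorem gaussBinom_eq_zero_of_lt {n i : ℕ} (h : n < i) : gaussBinom p n i = 0 := by
  induction n generalizing i with
  | zero =>
    obtain ⟨i, rfl⟩ := Nat.exists_eq_succ_of_ne_zero (Nat.ne_of_gt h)
    rfl
  | succ n ih =>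
    obtain ⟨i, rfl⟩ := Nat.exists_eq_succ_of_ne_zero (Nat.ne_zero_of_lt h)
    rw [Nat.succ_eq_add_one, gaussBinom_succ_succ, ih (by omega), ih (by omega)]
    ring

theorem gaussBinom_self (n : ℕ) : gaussBinom p n n = 1 := by
  induction n with
  | zero => rfl
  | succ n ih =>
    rw [gaussBinom_succ_succ, ih, gaussBinom_eq_zero_of_lt p n.lt_succ_self]
    ring

theorem gaussBinom_add_mul_prod (m i : ℕ) :
    gaussBinom p (m + i) i * ((∏ t ∈ range i, (1 - p * p ^ t)) * ∏ t ∈ range m, (1 - p * p ^ t)) =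
      ∏ t ∈ range (m + i), (1 - p * p ^ t) := by
  induction i generalizing m with
  | zero => simp [gaussBinom_zero_right]
  | succ i ihi =>
    induction m with
    | zero => simp [gaussBinom_self]
    | succ m ihm =>
      have h₁ := ihi (m + 1)
      have h₂ := ihm
      rw [show m + 1 + i = m + (i + 1) by ring] at h₁
      rw [show m + 1 + (i + 1) = m + (i + 1) + 1 by ring, gaussBinom_succ_succ,
        prod_range_succ _ (m + (i + 1))]
      rw [prod_range_succ _ m] at h₁ ⊢
      rw [prod_range_succ _ i] at h₂ ⊢
      linear_combination (1 - p * p ^ i) * h₁ + p ^ (i + 1) * (1 - p * p ^ m) * h₂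

/-- The finite `q`-binomial theorem. -/
theorem sum_gaussBinom (n : ℕ) (x : R) :
    ∑ i ∈ range (n + 1), (-x) ^ i * p ^ (i.choose 2) * gaussBinom p n i =
      ∏ t ∈ range n, (1 - x * p ^ t) := by
  induction n generalizing x with
  | zero => simp [gaussBinom_zero_right]
  | succ n ih =>
    have hprod : ∏ t ∈ range (n + 1), (1 - x * p ^ t) =
        (1 - x) * ∏ t ∈ range n, (1 - x * p * p ^ t) := by
      rw [prod_range_succ', mul_comm]
      simp only [pow_zero, mul_one, pow_succ', mul_assoc]
    have hext := sum_range_succ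
      (fun i => (-(x * p)) ^ i * p ^ (i.choose 2) * gaussBinom p n i) (n + 1)
    rw [gaussBinom_eq_zero_of_lt p n.lt_succ_self, mul_zero, add_zero, sum_range_succ'] at hext
    rw [hprod, sub_mul, one_mul, ← ih, mul_sum]
    nth_rewrite 1 [← hext]
    rw [sum_range_succ', add_sub_right_comm, ← sum_sub_distrib]
    simp only [gaussBinom_zero_right]
    congr 1
    · refine sum_congr rfl fun i _ => ?_
      rw [gaussBinom_succ_succ, Nat.choose_succ_succ', Nat.choose_one_right]
      simp only [neg_pow (x * p), neg_pow x, mul_pow]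
      ring
    · simp

end GaussBinom

theorem q_ne_zero : q ≠ 0 := RatFunc.X_ne_zero

theorem one_sub_q_pow_ne_zero {n : ℕ} (hn : n ≠ 0) : 1 - q ^ n ≠ 0 := by
  intro h
  have h' : algebraMap (Polynomial ℚ) F (Polynomial.X ^ n) = algebraMap (Polynomial ℚ) F 1 := by
    rw [map_pow, map_one, RatFunc.algebraMap_X]
    exact (sub_eq_zero.mp h).symm
  have hdeg := congrArg Polynomial.natDegree (RatFunc.algebraMap_injective ℚ h')
  rw [Polynomial.natDegree_X_pow, Polynomial.natDegree_one] at hdeg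
  exact hn hdeg

theorem qp_ne_zero (m : ℕ) : qp m ≠ 0 := by
  unfold qp qPoch
  refine prod_ne_zero_iff.mpr fun i _ => ?_
  rw [← pow_succ', ← pow_mul]
  exact one_sub_q_pow_ne_zero (by omega)

theorem qbin_eq_gaussBinom {n i : ℕ} (h : i ≤ n) : qbin n i = gaussBinom (q ^ 2) n i := by
  obtain ⟨m, rfl⟩ := Nat.exists_eq_add_of_le' h
  rw [qbin, div_eq_iff (mul_ne_zero (qp_ne_zero _) (qp_ne_zero _)), Nat.add_sub_cancel]
  exact (gaussBinom_add_mul_prod (q ^ 2) m i).symm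

theorem qbin_mul_qbin (n i k : ℕ) :
    qbin (k + i) k * qbin (k + n) (k + i) = qbin (k + n) k * qbin n i := by
  have hki := qp_ne_zero (k + i)
  have hn := qp_ne_zero n
  simp only [qbin, Nat.add_sub_cancel_left, Nat.add_sub_add_left]
  field_simp

/-- Product form of the rescaled top twist rule on `UP[j,k]`:
`∑_{h=k}^{j} (−q)^{h−j} q^{h²} [h;k]₊ [j;h]₊ = (−q)^{k−j} q^{k²} (q^{2+2k};q²)_{j−k} [j;k]₊`. -/
theorem product_form_T_UP (j k : ℕ) (hk : k ≤ j) :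
    ∑ h ∈ Finset.Icc k j, (-q) ^ ((h : ℤ) - (j : ℤ)) * q ^ (h ^ 2) * qbin h k * qbin j h =
      (-q) ^ ((k : ℤ) - (j : ℤ)) * q ^ (k ^ 2) *
        qPoch (q ^ (2 + 2 * k)) (q ^ 2) (j - k) * qbin j k := by
  obtain ⟨n, rfl⟩ := Nat.exists_eq_add_of_le hk
  have hsum := sum_gaussBinom (q ^ 2) n (q ^ (2 + 2 * k))
  rw [qPoch, Nat.add_sub_cancel_left, ← hsum, mul_sum, sum_mul, ← Ico_add_one_right_eq_Icc,
    sum_Ico_eq_sum_range, show k + n + 1 - k = n + 1 by omega]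
  refine sum_congr rfl fun i hi => ?_
  have hi' : i ≤ n := mem_range_succ_iff.mp hi
  have hpow : (-q) ^ (((k + i : ℕ) : ℤ) - ((k + n : ℕ) : ℤ)) =
      (-q) ^ ((k : ℤ) - ((k + n : ℕ) : ℤ)) * (-q) ^ i := by
    rw [← zpow_natCast, ← zpow_add₀ (neg_ne_zero.mpr q_ne_zero)]
    congr 1
    push_cast
    ring
  have hexp : i + (k + i) ^ 2 = k ^ 2 + (2 + 2 * k) * i + 2 * i.choose 2 := by
    have : i.choose 2 * 2 + i = i * i := by
      rw [Nat.choose_two_right, Nat.div_mul_cancel (Nat.even_mul_pred_self i).two_dvd]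
      cases i with
      | zero => rfl
      | succ i => simp; ring
    linarith
  have hq : (-q) ^ i * q ^ ((k + i) ^ 2) =
      q ^ (k ^ 2) * ((-q ^ (2 + 2 * k)) ^ i * (q ^ 2) ^ i.choose 2) := by
    rw [neg_pow q, neg_pow (q ^ (2 + 2 * k)), mul_assoc, ← pow_add, hexp]
    ring
  rw [hpow, mul_assoc _ (qbin _ _), qbin_mul_qbin, qbin_eq_gaussBinom hi']
  linear_combination (-q) ^ ((k : ℤ) - ((k + n : ℕ) : ℤ)) * qbin (k + n) k *
    gaussBinom (q ^ 2) n i * hq
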